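/- The number of families of n non-intersecting lattice paths on ℤ, where path i starts at position i at time 0 and ends at position 2i at time n+1, and at each of the n+1 time steps each path either stays or moves +1, with no two paths ever occupying the same position at the same time, equals 2^{n(n+1)/2}. -/

import Mathlib

section
open Matrix Polynomial

noncomputable def hhP (N : ℚ) (j : ℕ) : ℚ[X] := (C N - X) * X ^ j + X * (X + C (-1)) ^ j

lemma hhP_coeff_ge (N : ℚ) (j k : ℕ) (h : j ≤ k) :
    (hhP N j).coeff k = if k = j then N - j else 0 := by
  have e : hhP N j = C N * X ^ j - X ^ (j+1) + X * (X + C (-1)) ^ j := by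
    unfold hhP; ring
  rw [e]
  rcases k with _ | k
  · obtain rfl : j = 0 := by omega
    simp
  · rw [coeff_add, coeff_sub, coeff_C_mul, coeff_X_pow, coeff_X_pow, coeff_X_mul, coeff_X_add_C_pow]
    rcases Nat.lt_trichotomy j (k+1) with h1 | h1 | h1
    · rcases Nat.lt_or_ge j k with h2 | h2
      · rw [Nat.choose_eq_zero_of_lt h2, if_neg (by omega), if_neg (by omega), if_neg (by omega)]
        simp
      · obtain rfl : j = k := by omega
        simp
    · subst h1
      simp
      ring
    · omega

lemma hh_det (n : ℕ) (N : ℚ) (v : Fin n → ℚ) :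
    Matrix.det (Matrix.of fun i j : Fin n => (N - v i) * v i ^ (j:ℕ) + v i * (v i - 1) ^ (j:ℕ))
      = (vandermonde v).det * ∏ j : Fin n, (N - (j:ℕ)) := by
  have h := Matrix.eval_matrixOfPolynomials_eq_vandermonde_mul_matrixOfPolynomials v
    (fun j : Fin n => hhP N j) (by
      intro i
      rw [natDegree_le_iff_coeff_eq_zero]
      intro k hk
      rw [hhP_coeff_ge _ _ _ hk.le, if_neg (by omega)])
  have e : (Matrix.of fun i j : Fin n => (N - v i) * v i ^ (j:ℕ) + v i * (v i - 1) ^ (j:ℕ))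
      = (Matrix.of fun i j : Fin n => ((hhP N j).eval (v i))) := by
    ext i j
    simp [hhP, sub_eq_add_neg]
  rw [e, h, det_mul]
  congr 1
  rw [det_of_isUpperTriangular]
  · refine Finset.prod_congr rfl fun j _ => ?_
    simp [hhP_coeff_ge]
  · intro i j hij
    simp only [id] at hij
    have hij' : (j:ℕ) < i := hij
    simp [hhP_coeff_ge _ _ _ hij'.le, hij'.ne']

lemma hh_sum (n : ℕ) (N : ℚ) (v : Fin n → ℚ) :
    ∑ e : Fin n → Fin 2, (∏ i, (if e i = 0 then N - v i else v i)) *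
        (vandermonde (fun i => v i - ((e i : ℕ) : ℚ))).det
      = (vandermonde v).det * ∏ j : Fin n, (N - (j:ℕ)) := by
  rw [← hh_det]
  have := (detRowAlternating (R := ℚ) (n := Fin n)).toMultilinearMap.map_sum
    (fun (i : Fin n) (e : Fin 2) (j : Fin n) =>
      (if e = 0 then N - v i else v i) * (v i - ((e : ℕ) : ℚ)) ^ (j:ℕ))
  have e1 : (fun i : Fin n => ∑ e : Fin 2, (fun (j : Fin n) =>
      (if e = 0 then N - v i else v i) * (v i - ((e : ℕ) : ℚ)) ^ (j:ℕ))) =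
      (Matrix.of fun i j : Fin n => (N - v i) * v i ^ (j:ℕ) + v i * (v i - 1) ^ (j:ℕ)) := by
    ext i j
    simp [Fin.sum_univ_two]
  rw [e1] at this
  refine Eq.trans ?_ this.symm
  refine Finset.sum_congr rfl fun e _ => ?_
  exact (det_mul_column _ _).symm

noncomputable def hhg (k : ℤ) : ℚ := if 0 ≤ k then 1 / (k.toNat.factorial : ℚ) else 0

lemma hhg_rec (k : ℤ) : hhg (k - 1) = k * hhg k := by
  unfold hhg
  rcases lt_trichotomy k 0 with h | h | h
  · rw [if_neg (by omega), if_neg (by omega)]; simp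
  · subst h; simp
  · obtain ⟨m, rfl⟩ : ∃ m : ℕ, k = m + 1 := ⟨(k-1).toNat, by omega⟩
    rw [if_pos (by omega), if_pos (by omega)]
    have : ((m:ℤ)+1).toNat = m + 1 := by omega
    rw [this]
    simp [Nat.factorial_succ]
    field_simp

noncomputable def hhF (n m : ℕ) (y : Fin n → ℤ) : ℚ :=
  (vandermonde (fun i => (y i : ℚ) - 1)).det *
    ∏ i : Fin n, (((m + i : ℕ).factorial : ℚ) * (hhg (y i - 1) * hhg (n + m - y i)))

lemma hhF_rec (n m : ℕ) (y : Fin n → ℤ) :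
    ∑ e : Fin n → Fin 2, hhF n m (fun i => y i - ((e i : ℕ) : ℤ)) = hhF n (m+1) y := by
  have h := hh_sum n (n + m) (fun i => (y i : ℚ) - 1)
  have key : ∀ e : Fin n → Fin 2, hhF n m (fun i => y i - ((e i : ℕ) : ℤ)) =
      ((∏ i, (if e i = 0 then ((n:ℚ) + m) - ((y i : ℚ) - 1) else ((y i : ℚ) - 1))) *
        (vandermonde (fun i => ((y i : ℚ) - 1) - ((e i : ℕ) : ℚ))).det) *
      ∏ i : Fin n, (((m + i : ℕ).factorial : ℚ) * (hhg (y i - 1) * hhg (n + (m+1) - y i))) := by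
    intro e
    unfold hhF
    have : ∀ i : Fin n, (((m + i : ℕ).factorial : ℚ) * (hhg (y i - ((e i : ℕ) : ℤ) - 1) *
        hhg (n + m - (y i - ((e i : ℕ) : ℤ))))) =
        (if e i = 0 then ((n:ℚ) + m) - ((y i : ℚ) - 1) else ((y i : ℚ) - 1)) *
        (((m + i : ℕ).factorial : ℚ) * (hhg (y i - 1) * hhg (n + (m+1) - y i))) := by
      intro i
      have h2 : e i = 0 ∨ e i = 1 := by
        generalize e i = a; fin_cases a <;> simp
      rcases h2 with h2 | h2
      · rw [h2]
        have := hhg_rec (n + (m+1) - y i)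
        rw [show (n + (m+1) - y i - 1 : ℤ) = n + m - y i by ring] at this
        simp [this]
        ring
      · rw [h2]
        have := hhg_rec (y i - 1)
        simp [this, show (n + m - (y i - 1) : ℤ) = n + (m+1) - y i by ring]
        ring
    simp only [this]
    rw [Finset.prod_mul_distrib]
    have e3 : (fun i => (((y i - ((e i : ℕ) : ℤ) : ℤ)) : ℚ) - 1) =
      (fun i => ((y i : ℚ) - 1) - ((e i : ℕ) : ℚ)) := by
      ext i; push_cast; ring
    rw [e3]
    ring
  simp only [key]
  rw [← Finset.sum_mul, h]
  unfold hhF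
  rw [mul_assoc]
  congr 1
  have e4 : ∏ j : Fin n, ((n:ℚ) + m - (j:ℕ)) = ∏ j : Fin n, ((m:ℚ) + 1 + (j:ℕ)) := by
    rw [← Equiv.prod_comp Fin.revPerm]
    refine Finset.prod_congr rfl fun j _ => ?_
    have := j.2
    simp only [Fin.revPerm_apply, Fin.val_rev]
    rw [Nat.cast_sub (by omega)]
    push_cast; ring
  rw [e4, ← Finset.prod_mul_distrib]
  refine Finset.prod_congr rfl fun j _ => ?_
  rw [show m + 1 + (j:ℕ) = (m + j) + 1 by ring, Nat.factorial_succ]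
  push_cast
  ring

def hhS (n m : ℕ) (y : Fin n → ℤ) : Set (Fin (m + 1) → Fin n → ℤ) :=
  {x | (∀ i, x 0 i = (i.1 : ℤ) + 1) ∧ (∀ i, x (Fin.last m) i = y i) ∧
      (∀ t : Fin m, ∀ i, x t.succ i - x t.castSucc i ∈ ({0, 1} : Set ℤ)) ∧
      (∀ t, StrictMono (x t))}

lemma hhS_snoc (n m : ℕ) (y w : Fin n → ℤ) (hy : StrictMono y) (x : Fin (m + 1) → Fin n → ℤ)
    (hx : x ∈ hhS n m w) (hw : ∀ i, y i - w i ∈ ({0, 1} : Set ℤ)) :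
    (Fin.snoc x y : Fin (m + 2) → Fin n → ℤ) ∈ hhS n (m + 1) y := by
  obtain ⟨h0, h1, h2, h3⟩ := hx
  refine ⟨?_, ?_, ?_, ?_⟩
  · intro i
    rw [← Fin.castSucc_zero, Fin.snoc_castSucc]; exact h0 i
  · intro i
    rw [Fin.snoc_last]
  · intro t i
    rw [Fin.snoc_castSucc]
    induction t using Fin.lastCases with
    | last => rw [Fin.succ_last, Fin.snoc_last, h1]; exact hw i
    | cast t => rw [Fin.succ_castSucc, Fin.snoc_castSucc]; exact h2 t i
  · intro t
    induction t using Fin.lastCases with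
    | last => rw [Fin.snoc_last]; exact hy
    | cast t => rw [Fin.snoc_castSucc]; exact h3 t

def hhMap (n m : ℕ) (y : Fin n → ℤ) (hy : StrictMono y) :
    (Σ e : Fin n → Fin 2, hhS n m (fun i => y i - ((e i : ℕ) : ℤ))) → hhS n (m + 1) y :=
  fun p => ⟨Fin.snoc p.2.1 y, hhS_snoc n m y _ hy _ p.2.2 (by
    intro i
    have h2 : p.1 i = 0 ∨ p.1 i = 1 := by
        generalize p.1 i = a; fin_cases a <;> simp
    rcases h2 with h2 | h2 <;> simp [h2])⟩

lemma hhMap_bij (n m : ℕ) (y : Fin n → ℤ) (hy : StrictMono y) :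
    Function.Bijective (hhMap n m y hy) := by
  constructor
  · rintro ⟨e, x, hx⟩ ⟨e', x', hx'⟩ h
    have hxx : x = x' := by
      have h' := congrArg Subtype.val h
      simp only [hhMap] at h'
      exact (Fin.snoc_injective2 h').1
    subst hxx
    have : e = e' := by
      funext i
      have h1 : x (Fin.last m) i = y i - ((e i : ℕ) : ℤ) := hx.2.1 i
      have h2 : x (Fin.last m) i = y i - ((e' i : ℕ) : ℤ) := hx'.2.1 i
      apply Fin.ext
      omega
    subst this
    rfl
  · rintro ⟨z, h0, h1, h2, h3⟩
    have hl := h2 (Fin.last m)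
    refine ⟨⟨fun i => if z (Fin.last m).succ i - z (Fin.last m).castSucc i = 0 then 0 else 1,
      ⟨Fin.init z, ?_, ?_, ?_, ?_⟩⟩, ?_⟩
    · intro i; exact h0 i
    · intro i
      have := hl i
      have h1 : z (Fin.last m.succ) i = y i := h1 i
      rw [Fin.succ_last] at this
      simp only [Fin.succ_last]
      simp only [Set.mem_insert_iff, Set.mem_singleton_iff] at this
      show z (Fin.last m).castSucc i = _
      rcases this with h | h
      · simp [h]; omega
      · simp [h]; omega
    · intro t i
      exact h2 t.castSucc i
    · intro t; exact h3 _
    · apply Subtype.ext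
      simp only [hhMap]
      have : y = z (Fin.last (m+1)) := by funext i; exact (h1 i).symm
      rw [this]
      exact Fin.snoc_init_self z

lemma hh_vand_id (n : ℕ) :
    (vandermonde (fun i : Fin n => ((i : ℕ) : ℚ))).det = ∏ i : Fin n, ((i : ℕ).factorial : ℚ) := by
  rcases n with _ | n
  · simp
  · rw [det_vandermonde_id_eq_superFactorial, ← Nat.prod_range_factorial_succ,
      Fin.prod_univ_succ]
    simp [Finset.prod_range]

lemma hhg_nat (k : ℕ) : hhg k = 1 / (k.factorial : ℚ) := by simp [hhg]

lemma hh_strict_eq (n : ℕ) (y : Fin n → ℤ) (hy : StrictMono y) (h1 : ∀ i, 1 ≤ y i)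
    (h2 : ∀ i, y i ≤ n) (i : Fin n) : y i = (i.1 : ℤ) + 1 := by
  have lo : ∀ k : ℕ, ∀ hk : k < n, (k : ℤ) + 1 ≤ y ⟨k, hk⟩ := by
    intro k
    induction k with
    | zero => intro hk; simpa using h1 _
    | succ k ih =>
      intro hk
      have a := ih (by omega)
      have b : y ⟨k, by omega⟩ < y ⟨k+1, hk⟩ := hy (by simp)
      push_cast; omega
  have hi : ∀ k : ℕ, ∀ hk : k < n, y ⟨n - 1 - k, by omega⟩ ≤ (n : ℤ) - k := by
    intro k
    induction k with
    | zero => intro hk; simpa using h2 _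
    | succ k ih =>
      intro hk
      have a := ih (by omega)
      have b : y ⟨n - 1 - (k+1), by omega⟩ < y ⟨n - 1 - k, by omega⟩ :=
        hy (by simp only [Fin.mk_lt_mk]; omega)
      push_cast; omega
  have a := lo i i.2
  have b := hi (n - 1 - i) (by omega)
  have c : (⟨n - 1 - (n - 1 - i), by omega⟩ : Fin n) = i := by
    apply Fin.ext; simp only; omega
  rw [c] at b
  have a' : (i : ℤ) + 1 ≤ y i := a
  omega

lemma hhF_base (n : ℕ) : hhF n 0 (fun i => (i.1 : ℤ) + 1) = 1 := by
  unfold hhF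
  have : (fun i : Fin n => (((i.1 : ℤ) + 1 : ℤ) : ℚ) - 1) = fun i : Fin n => ((i : ℕ) : ℚ) := by
    ext i; push_cast; ring
  rw [this, hh_vand_id, ← Equiv.prod_comp Fin.revPerm, ← Finset.prod_mul_distrib]
  refine Finset.prod_eq_one fun i _ => ?_
  have e1 : ((i.1 : ℤ) + 1 - 1) = (i.1 : ℕ) := by ring
  have e2 : ((n : ℤ) + (0 : ℕ) - ((i.1 : ℤ) + 1)) = ((Fin.revPerm i : Fin n) : ℕ) := by
    simp only [Fin.revPerm_apply, Fin.val_rev]; omega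
  rw [e1, e2, hhg_nat, hhg_nat, zero_add]
  have := Nat.factorial_ne_zero (i : ℕ)
  have := Nat.factorial_ne_zero ((Fin.revPerm i : Fin n) : ℕ)
  field_simp

lemma hh_count (n m : ℕ) : ∀ y : Fin n → ℤ, Finite (hhS n m y) ∧
    (StrictMono y → (Nat.card (hhS n m y) : ℚ) = hhF n m y) := by
  induction m with
  | zero =>
    intro y
    have hsub : (hhS n 0 y).Subsingleton := by
      intro a ha b hb
      funext t i
      have ht : t = 0 := by apply Fin.ext; simp only [Fin.val_zero]; omega
      rw [ht, ha.1, hb.1]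
    refine ⟨hsub.finite, fun hy => ?_⟩
    by_cases h : y = fun i => (i.1 : ℤ) + 1
    · subst h
      rw [hhF_base]
      have : hhS n 0 (fun i => (i.1 : ℤ) + 1) = {fun _ i => (i.1 : ℤ) + 1} := by
        apply hsub.eq_singleton_of_mem
        exact ⟨fun i => rfl, fun i => rfl, fun t => t.elim0, fun t => hy⟩
      rw [this]; simp
    · have he : hhS n 0 y = ∅ := by
        rw [Set.eq_empty_iff_forall_notMem]
        intro x hx
        apply h
        funext i
        rw [← hx.1 i, ← hx.2.1 i]; rfl
      rw [he]
      simp only [Nat.card_of_isEmpty, Nat.cast_zero]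
      symm
      by_contra hF
      apply h
      have hp := right_ne_zero_of_mul hF
      rw [Finset.prod_ne_zero_iff] at hp
      have hp' : ∀ i, 1 ≤ y i ∧ y i ≤ n := by
        intro i
        have := right_ne_zero_of_mul (hp i (Finset.mem_univ i))
        have a := left_ne_zero_of_mul this
        have b := right_ne_zero_of_mul this
        unfold hhg at a b
        simp only [ne_eq, ite_eq_right_iff, Classical.not_imp] at a b
        have := a.1
        have := b.1
        omega
      funext i
      exact hh_strict_eq n y hy (fun i => (hp' i).1) (fun i => (hp' i).2) i
  | succ m ih =>
    intro y
    by_cases hy : StrictMono y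
    · have := fun e : Fin n → Fin 2 => (ih (fun i => y i - ((e i : ℕ) : ℤ))).1
      let E := Equiv.ofBijective _ (hhMap_bij n m y hy)
      refine ⟨Finite.of_equiv _ E, fun _ => ?_⟩
      rw [← Nat.card_congr E, Nat.card_sigma, ← hhF_rec]
      push_cast
      refine Finset.sum_congr rfl fun e _ => ?_
      by_cases hs : StrictMono (fun i => y i - ((e i : ℕ) : ℤ))
      · exact (ih _).2 hs
      · have hem : hhS n m (fun i => y i - ((e i : ℕ) : ℤ)) = ∅ := by
          rw [Set.eq_empty_iff_forall_notMem]
          intro x hx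
          apply hs
          have := hx.2.2.2 (Fin.last m)
          rwa [show x (Fin.last m) = _ from funext hx.2.1] at this
        rw [hem]
        simp only [Nat.card_of_isEmpty, Nat.cast_zero]
        symm
        have hmono : Monotone (fun i => y i - ((e i : ℕ) : ℤ)) := by
          intro i j hij
          rcases hij.eq_or_lt with rfl | hij
          · exact le_rfl
          · have := hy hij
            simp only
            omega
        unfold hhF
        apply mul_eq_zero_of_left
        by_contra hdet
        rw [← ne_eq, det_vandermonde_ne_zero_iff] at hdet
        apply hs
        apply hmono.strictMono_of_injective
        intro i j hij
        apply hdet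
        simp only at hij ⊢
        rw [hij]
    · have hem : hhS n (m+1) y = ∅ := by
        rw [Set.eq_empty_iff_forall_notMem]
        intro x hx
        apply hy
        have := hx.2.2.2 (Fin.last (m+1))
        rwa [show x (Fin.last (m+1)) = _ from funext hx.2.1] at this
      rw [hem]
      exact ⟨inferInstance, fun h => absurd h hy⟩

lemma hh_fact_nat (n : ℕ) :
    ∏ i ∈ Finset.range n, (i.factorial * (n + 1 + i).factorial) =
      2 ^ n * (∏ i ∈ Finset.range n, (2 * i + 1).factorial) ^ 2 := by
  induction n with
  | zero => simp
  | succ n ih =>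
    rw [Finset.prod_mul_distrib] at ih ⊢
    have h1 : (∏ i ∈ Finset.range (n+1), (n + 1 + 1 + i).factorial) * (n+1).factorial =
        (∏ i ∈ Finset.range n, (n + 1 + i).factorial) * (2*n+1).factorial * (2*n+2).factorial := by
      have a := Finset.prod_range_succ (fun i => (n + 1 + i).factorial) (n+1)
      have b := Finset.prod_range_succ' (fun i => (n + 1 + i).factorial) (n+1)
      rw [a, Finset.prod_range_succ (fun i => (n + 1 + i).factorial) n] at b
      rw [show 2*n+1 = n + 1 + n by ring, show 2*n+2 = n+1+(n+1) by ring, b]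
      simp only [add_zero]
      congr 1
      refine Finset.prod_congr rfl fun i _ => ?_
      congr 1; ring
    have h2 : (2*n+2).factorial = 2 * (n+1) * (2*n+1).factorial := by
      rw [Nat.factorial_succ]; ring
    apply Nat.eq_of_mul_eq_mul_right (Nat.factorial_pos (n+1))
    rw [mul_assoc, h1, Finset.prod_range_succ, Finset.prod_range_succ, h2, Nat.factorial_succ n]
    linear_combination (n.factorial * (2 * (n+1) * (2*n+1).factorial^2)) * ih

lemma hhF_target (n : ℕ) :
    hhF n (n + 1) (fun i => 2 * ((i.1 : ℤ) + 1)) = 2 ^ (n * (n + 1) / 2) := by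
  have hv : (vandermonde (fun i : Fin n => (((2 * ((i.1 : ℤ) + 1) : ℤ)) : ℚ) - 1)).det =
      (∏ i : Fin n, (2:ℚ) ^ (i : ℕ)) * ∏ i : Fin n, ((i : ℕ).factorial : ℚ) := by
    rw [det_vandermonde_sub, ← hh_vand_id, ← det_vandermonde_add (fun i : Fin n => ((i : ℕ) : ℚ)) 1, ← det_mul_row]
    congr 1
    ext i j
    simp only [vandermonde_apply, of_apply, ← mul_pow]
    push_cast
    rfl
  have hg : ∀ i : Fin n, hhg (2 * ((i.1 : ℤ) + 1) - 1) = 1 / ((2 * (i : ℕ) + 1).factorial : ℚ) := by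
    intro i
    rw [← hhg_nat]; congr 1; push_cast; ring
  have hg' : ∀ i : Fin n, hhg (n + (n + 1 : ℕ) - 2 * ((i.1 : ℤ) + 1)) =
      1 / ((2 * ((Fin.revPerm i : Fin n) : ℕ) + 1).factorial : ℚ) := by
    intro i
    rw [← hhg_nat]; congr 1
    simp only [Fin.revPerm_apply, Fin.val_rev]; omega
  unfold hhF
  rw [hv]
  simp only [hg, hg']
  rw [Finset.prod_mul_distrib, Finset.prod_mul_distrib,
    Equiv.prod_comp Fin.revPerm (fun i : Fin n => 1 / ((2 * (i : ℕ) + 1).factorial : ℚ))]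
  have hf := congrArg (Nat.cast (R := ℚ)) (hh_fact_nat n)
  rw [Finset.prod_mul_distrib, Finset.prod_range, Finset.prod_range, Finset.prod_range] at hf
  push_cast at hf
  simp only [one_div, Finset.prod_inv_distrib]
  have hne : (∏ i : Fin n, ((2 * (i : ℕ) + 1).factorial : ℚ)) ≠ 0 :=
    Finset.prod_ne_zero_iff.2 fun i _ => by exact_mod_cast Nat.factorial_ne_zero _
  have hp : (∏ i : Fin n, (2:ℚ) ^ (i : ℕ)) * 2 ^ n = 2 ^ (n * (n + 1) / 2) := by
    rw [← Finset.prod_range (fun i => (2:ℚ) ^ i), ← Finset.prod_range_succ,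
      Finset.prod_pow_eq_pow_sum, Finset.sum_range_id]
    congr 2
    simp [mul_comm]
  rw [← hp]
  field_simp
  linear_combination hf

end



/-- The number of families of `n` non-intersecting lattice paths, where path `i` goes from
position `i` at time `0` to position `2i` at time `n+1`, each step staying or moving `+1`,
with the paths strictly ordered at every time, equals `2^{n(n+1)/2}`. -/
theorem half_hexagon_path_count (n : ℕ) :
    Set.ncard {x : Fin (n + 2) → Fin n → ℤ |
      (∀ i, x 0 i = (i.1 : ℤ) + 1) ∧
      (∀ i, x (Fin.last (n + 1)) i = 2 * ((i.1 : ℤ) + 1)) ∧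
      (∀ t : Fin (n + 1), ∀ i, x t.succ i - x t.castSucc i ∈ ({0, 1} : Set ℤ)) ∧
      (∀ t, StrictMono (x t))} = 2 ^ (n * (n + 1) / 2) := by
  have hy : StrictMono (fun i : Fin n => 2 * ((i.1 : ℤ) + 1)) := by
    intro i j hij
    have : (i : ℕ) < j := hij
    simp only
    omega
  have h := (hh_count n (n + 1) (fun i => 2 * ((i.1 : ℤ) + 1))).2 hy
  rw [hhF_target] at h
  have h' : Nat.card (hhS n (n + 1) (fun i => 2 * ((i.1 : ℤ) + 1))) = 2 ^ (n * (n + 1) / 2) := by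
    exact_mod_cast h
  exact h'
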